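/- The polynomial function f : ℝ² → ℝ given by f(x,y) = (x² + y⁴ − 2y²)·(x + y² − 1) has only nondegenerate critical points, and it has exactly ten critical points, of which exactly three are local minima, exactly five are saddles, and exactly two are local maxima. -/

import Mathlib

/-- A point `p = (x₀, y₀)` is a critical point of `f : ℝ → ℝ → ℝ` if both
partial derivatives of `f` vanish at `p`. -/
def IsCriticalPt (f : ℝ → ℝ → ℝ) (p : ℝ × ℝ) : Prop :=
  deriv (fun t => f t p.2) p.1 = 0 ∧ deriv (fun t => f p.1 t) p.2 = 0

/-- The Hessian determinant `f_xx(p) * f_yy(p) - f_xy(p)^2` of `f` at `p`. -/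
noncomputable def hessDet (f : ℝ → ℝ → ℝ) (p : ℝ × ℝ) : ℝ :=
  deriv (fun x => deriv (fun t => f t p.2) x) p.1 *
      deriv (fun y => deriv (fun t => f p.1 t) y) p.2 -
    (deriv (fun y => deriv (fun t => f t y) p.1) p.2) ^ 2

/-- `p` is a local minimum point of the function `(x, y) ↦ f x y`. -/
def IsLocMin (f : ℝ → ℝ → ℝ) (p : ℝ × ℝ) : Prop :=
  IsLocalMin (fun q : ℝ × ℝ => f q.1 q.2) p

/-- `p` is a local maximum point of the function `(x, y) ↦ f x y`. -/
def IsLocMax (f : ℝ → ℝ → ℝ) (p : ℝ × ℝ) : Prop :=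
  IsLocalMax (fun q : ℝ × ℝ => f q.1 q.2) p

/-- A saddle is a critical point that is neither a local minimum
nor a local maximum. -/
def IsSaddle (f : ℝ → ℝ → ℝ) (p : ℝ × ℝ) : Prop :=
  IsCriticalPt f p ∧ ¬ IsLocMin f p ∧ ¬ IsLocMax f p

/-- Realizing polynomial (J₁₀¹, ten critical points, two maxima). -/
noncomputable def f7 : ℝ → ℝ → ℝ := fun x y => (x ^ 2 + y ^ 4 - 2 * y ^ 2) * (x + y ^ 2 - 1)

open Filter Topology

lemma hasDerivAt_f7_fst (x y : ℝ) :
    HasDerivAt (fun t => f7 t y) (3 * x ^ 2 + 2 * x * (y ^ 2 - 1) + (y ^ 2 - 1) ^ 2 - 1) x := by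
  have h := (((hasDerivAt_id' x).pow 2).add_const (y ^ 4 - 2 * y ^ 2)).mul
    ((hasDerivAt_id' x).add_const (y ^ 2 - 1))
  refine (h.congr_deriv ?_).congr_of_eventuallyEq (.of_forall fun t => ?_)
  · simp; ring
  · simp [f7]; ring

lemma hasDerivAt_f7_snd (x y : ℝ) :
    HasDerivAt (fun t => f7 x t)
      (2 * (y * (x ^ 2 + 2 * x * (y ^ 2 - 1) + 3 * (y ^ 2 - 1) ^ 2 - 1))) y := by
  have h := ((((hasDerivAt_id' y).pow 4).sub (((hasDerivAt_id' y).pow 2).const_mul 2)).const_add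
    (x ^ 2)).mul (((hasDerivAt_id' y).pow 2).const_add (x - 1))
  refine (h.congr_deriv ?_).congr_of_eventuallyEq (.of_forall fun t => ?_)
  · simp; ring
  · simp [f7]; ring

lemma isCriticalPt_f7_iff (x y : ℝ) :
    IsCriticalPt f7 (x, y) ↔
      3 * x ^ 2 + 2 * x * (y ^ 2 - 1) + (y ^ 2 - 1) ^ 2 - 1 = 0 ∧
        y * (x ^ 2 + 2 * x * (y ^ 2 - 1) + 3 * (y ^ 2 - 1) ^ 2 - 1) = 0 := by
  simp only [IsCriticalPt, (hasDerivAt_f7_fst x y).deriv, (hasDerivAt_f7_snd x y).deriv,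
    mul_eq_zero_iff_left (two_ne_zero : (2 : ℝ) ≠ 0)]

lemma hessDet_f7 (x y : ℝ) :
    hessDet f7 (x, y) =
      (6 * x + 2 * (y ^ 2 - 1)) *
        (2 * (x ^ 2 + 2 * x * (y ^ 2 - 1) + 3 * (y ^ 2 - 1) ^ 2 - 1) +
          4 * y ^ 2 * (2 * x + 6 * (y ^ 2 - 1))) -
        (4 * y * (x + (y ^ 2 - 1))) ^ 2 := by
  have hy := ((hasDerivAt_id' y).pow 2).sub_const 1
  have hxx : HasDerivAt
      (fun t : ℝ => 3 * t ^ 2 + 2 * t * (y ^ 2 - 1) + (y ^ 2 - 1) ^ 2 - 1)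
      (6 * x + 2 * (y ^ 2 - 1)) x := by
    refine HasDerivAt.congr_deriv ((((((hasDerivAt_id' x).pow 2).const_mul 3).add
      (((hasDerivAt_id' x).const_mul 2).mul_const (y ^ 2 - 1))).add_const
        ((y ^ 2 - 1) ^ 2)).sub_const 1) ?_
    simp; ring
  have hxy : HasDerivAt
      (fun t : ℝ => 3 * x ^ 2 + 2 * x * (t ^ 2 - 1) + (t ^ 2 - 1) ^ 2 - 1)
      (4 * y * (x + (y ^ 2 - 1))) y := by
    refine HasDerivAt.congr_deriv
      ((((hy.const_mul (2 * x)).const_add (3 * x ^ 2)).add (hy.pow 2)).sub_const 1) ?_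
    simp; ring
  have hyy : HasDerivAt
      (fun t : ℝ => 2 * (t * (x ^ 2 + 2 * x * (t ^ 2 - 1) + 3 * (t ^ 2 - 1) ^ 2 - 1)))
      (2 * (x ^ 2 + 2 * x * (y ^ 2 - 1) + 3 * (y ^ 2 - 1) ^ 2 - 1) +
        4 * y ^ 2 * (2 * x + 6 * (y ^ 2 - 1))) y := by
    refine HasDerivAt.congr_deriv (((hasDerivAt_id' y).mul
      ((((hy.const_mul (2 * x)).const_add (x ^ 2)).add ((hy.pow 2).const_mul 3)).sub_const
        1)).const_mul 2) ?_
    simp; ring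
  simp only [hessDet, (hasDerivAt_f7_fst _ _).deriv, (hasDerivAt_f7_snd _ _).deriv,
    hxx.deriv, hxy.deriv, hyy.deriv]

/-- The critical points of `f7`, by type: the origin, the minimum on the axis, and the points off
the axis lying over the two diagonals in the coordinates `(x, y ^ 2 - 1)`. -/
lemma isCriticalPt_f7_iff_cases (x y : ℝ) :
    IsCriticalPt f7 (x, y) ↔
      (x = 0 ∧ y = 0) ∨ (x = 2 / 3 ∧ y = 0) ∨
        (y ^ 2 - 1 = x ∧ x ^ 2 = 1 / 6) ∨ (y ^ 2 - 1 = -x ∧ x ^ 2 = 1 / 2) := by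
  rw [isCriticalPt_f7_iff]
  constructor
  · rintro ⟨h₁, h₂⟩
    rcases mul_eq_zero.1 h₂ with rfl | h₂
    · have : x * (x - 2 / 3) = 0 := by linarith
      rcases mul_eq_zero.1 this with h | h
      · exact .inl ⟨h, rfl⟩
      · exact .inr (.inl ⟨by linarith, rfl⟩)
    · generalize y ^ 2 - 1 = v at *
      have : (v - x) * (v + x) = 0 := by linarith
      rcases mul_eq_zero.1 this with h | h
      · obtain rfl : v = x := by linarith
        exact .inr (.inr (.inl ⟨rfl, by linarith⟩))
      · obtain rfl : v = -x := by linarith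
        exact .inr (.inr (.inr ⟨rfl, by linarith⟩))
  · rintro (⟨rfl, rfl⟩ | ⟨rfl, rfl⟩ | ⟨h, hx⟩ | ⟨h, hx⟩)
    · norm_num
    · norm_num
    · rw [h]
      exact ⟨by linarith, mul_eq_zero_of_right _ (by linarith)⟩
    · rw [h]
      exact ⟨by linarith, mul_eq_zero_of_right _ (by linarith)⟩

lemma hessDet_f7_ne_zero {x y : ℝ} (h : IsCriticalPt f7 (x, y)) : hessDet f7 (x, y) ≠ 0 := by
  rw [hessDet_f7]
  rcases (isCriticalPt_f7_iff_cases x y).1 h with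
    ⟨rfl, rfl⟩ | ⟨rfl, rfl⟩ | ⟨h, hx⟩ | ⟨h, hx⟩
  · norm_num
  · norm_num
  · obtain hy : y ^ 2 = 1 + x := by linarith
    have h1 : 0 < 1 + x := by nlinarith
    have : (6 * x + 2 * x) * (2 * (x ^ 2 + 2 * x * x + 3 * x ^ 2 - 1) +
        4 * y ^ 2 * (2 * x + 6 * x)) - (4 * y * (x + x)) ^ 2 = 32 * (1 + x) := by
      linear_combination (192 * x ^ 2) * hy + (96 * x + 192 * (1 + x)) * hx
    rw [h, this]
    positivity
  · obtain hy : y ^ 2 = 1 - x := by linarith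
    have h1 : 0 < 1 - x := by nlinarith
    have : (6 * x + 2 * -x) * (2 * (x ^ 2 + 2 * x * -x + 3 * (-x) ^ 2 - 1) +
        4 * y ^ 2 * (2 * x + 6 * -x)) - (4 * y * (x + -x)) ^ 2 = -(32 * (1 - x)) := by
      linear_combination (-64 * x ^ 2) * hy + (16 * x - 64 * (1 - x)) * hx
    rw [h, this]
    exact neg_ne_zero.2 (by positivity)

lemma f7_fst_eq {x y : ℝ} (h : IsCriticalPt f7 (x, y)) (t : ℝ) :
    f7 t y = f7 x y + (t - x) ^ 2 * (2 * x + (y ^ 2 - 1) + t) := by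
  have h₁ := ((isCriticalPt_f7_iff x y).1 h).1
  simp only [f7]
  linear_combination (t - x) * h₁

lemma not_isLocMax_of_eventually {f : ℝ → ℝ → ℝ} {p : ℝ × ℝ} {γ : ℝ → ℝ × ℝ} {a : ℝ}
    (hγ : ContinuousAt γ a) (ha : γ a = p)
    (h : ∀ᶠ t in 𝓝[≠] a, f p.1 p.2 < f (γ t).1 (γ t).2) : ¬ IsLocMax f p := by
  intro hp
  have hγ' : Tendsto γ (𝓝[≠] a) (𝓝 p) := ha ▸ hγ.mono_left nhdsWithin_le_nhds
  obtain ⟨t, h₁, h₂⟩ := (h.and (hγ'.eventually hp)).exists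
  exact absurd h₂ (not_le.2 h₁)

lemma not_isLocMin_of_eventually {f : ℝ → ℝ → ℝ} {p : ℝ × ℝ} {γ : ℝ → ℝ × ℝ} {a : ℝ}
    (hγ : ContinuousAt γ a) (ha : γ a = p)
    (h : ∀ᶠ t in 𝓝[≠] a, f (γ t).1 (γ t).2 < f p.1 p.2) : ¬ IsLocMin f p := by
  intro hp
  have hγ' : Tendsto γ (𝓝[≠] a) (𝓝 p) := ha ▸ hγ.mono_left nhdsWithin_le_nhds
  obtain ⟨t, h₁, h₂⟩ := (h.and (hγ'.eventually hp)).exists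
  exact absurd h₂ (not_le.2 h₁)

/-- If `f (γ t) = f p + (t - a) ^ 2 * g t` with `g a > 0`, then `p = γ a` is not a local maximum. -/
lemma not_isLocMax_of_sq {f : ℝ → ℝ → ℝ} {p : ℝ × ℝ} {γ : ℝ → ℝ × ℝ} {g : ℝ → ℝ} {a : ℝ}
    (hγ : ContinuousAt γ a) (ha : γ a = p) (hg : ContinuousAt g a) (hga : 0 < g a)
    (h : ∀ t, f (γ t).1 (γ t).2 = f p.1 p.2 + (t - a) ^ 2 * g t) : ¬ IsLocMax f p := by
  refine not_isLocMax_of_eventually hγ ha ?_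
  filter_upwards [self_mem_nhdsWithin, nhdsWithin_le_nhds (hg.eventually_const_lt hga)] with t ht hgt
  have : 0 < (t - a) ^ 2 := sq_pos_of_ne_zero (sub_ne_zero.2 ht)
  rw [h]
  exact lt_add_of_pos_right _ (mul_pos this hgt)

lemma not_isLocMin_of_sq {f : ℝ → ℝ → ℝ} {p : ℝ × ℝ} {γ : ℝ → ℝ × ℝ} {g : ℝ → ℝ} {a : ℝ}
    (hγ : ContinuousAt γ a) (ha : γ a = p) (hg : ContinuousAt g a) (hga : g a < 0)
    (h : ∀ t, f (γ t).1 (γ t).2 = f p.1 p.2 + (t - a) ^ 2 * g t) : ¬ IsLocMin f p := by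
  refine not_isLocMin_of_eventually hγ ha ?_
  filter_upwards [self_mem_nhdsWithin, nhdsWithin_le_nhds (hg.eventually_lt_const hga)] with t ht hgt
  have : 0 < (t - a) ^ 2 := sq_pos_of_ne_zero (sub_ne_zero.2 ht)
  rw [h]
  exact add_lt_of_neg_right _ (mul_neg_of_pos_of_neg this hgt)

lemma not_isLocMax_f7 {x y : ℝ} (h : IsCriticalPt f7 (x, y)) (hpos : 0 < 3 * x + (y ^ 2 - 1)) :
    ¬ IsLocMax f7 (x, y) :=
  not_isLocMax_of_sq (γ := fun t => (t, y)) (g := fun t => 2 * x + (y ^ 2 - 1) + t) (a := x)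
    (by fun_prop) rfl (by fun_prop) (by linarith) (f7_fst_eq h)

lemma not_isLocMin_f7 {x y : ℝ} (h : IsCriticalPt f7 (x, y)) (hneg : 3 * x + (y ^ 2 - 1) < 0) :
    ¬ IsLocMin f7 (x, y) :=
  not_isLocMin_of_sq (γ := fun t => (t, y)) (g := fun t => 2 * x + (y ^ 2 - 1) + t) (a := x)
    (by fun_prop) rfl (by fun_prop) (by linarith) (f7_fst_eq h)

lemma f7_snd_eq {x y : ℝ} (h : y ^ 2 - 1 = -x) (hx : x ^ 2 = 1 / 2) (t : ℝ) :
    f7 x t = f7 x y + (t - y) ^ 2 * ((t + y) ^ 2 * (t ^ 2 - y ^ 2 - 2 * x)) := by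
  obtain hy : y ^ 2 = 1 - x := by linarith
  have e : (t - y) ^ 2 * ((t + y) ^ 2 * (t ^ 2 - y ^ 2 - 2 * x)) =
      (t ^ 2 - y ^ 2) ^ 2 * (t ^ 2 - y ^ 2 - 2 * x) := by ring
  have e' : y ^ 4 = (1 - x) ^ 2 := by rw [← hy]; ring
  rw [e]
  simp only [f7, e', hy]
  linear_combination (2 * (t ^ 2 - 1 + x)) * hx

lemma isSaddle_f7_origin : IsSaddle f7 (0, 0) := by
  have h : IsCriticalPt f7 (0, 0) := (isCriticalPt_f7_iff_cases _ _).2 (.inl ⟨rfl, rfl⟩)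
  refine ⟨h, not_isLocMin_f7 h (by norm_num), ?_⟩
  exact not_isLocMax_of_sq (γ := fun t => (0, t)) (g := fun t => (t ^ 2 - 2) * (t ^ 2 - 1)) (a := 0)
    (by fun_prop) rfl (by fun_prop) (by norm_num) (fun t => by simp only [f7]; ring)

lemma isSaddle_f7 {x y : ℝ} (h : y ^ 2 - 1 = -x) (hx : x ^ 2 = 1 / 2) : IsSaddle f7 (x, y) := by
  have hc : IsCriticalPt f7 (x, y) :=
    (isCriticalPt_f7_iff_cases _ _).2 (.inr (.inr (.inr ⟨h, hx⟩)))
  have hy : 0 < (y + y) ^ 2 := by nlinarith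
  have hx0 : x ≠ 0 := by rintro rfl; norm_num at hx
  rcases hx0.lt_or_gt with hneg | hpos
  · refine ⟨hc, not_isLocMin_f7 hc (by linarith), ?_⟩
    exact not_isLocMax_of_sq (γ := fun t => (x, t)) (a := y)
      (g := fun t => (t + y) ^ 2 * (t ^ 2 - y ^ 2 - 2 * x))
      (by fun_prop) rfl (by fun_prop) (mul_pos hy (by linarith)) (f7_snd_eq h hx)
  · refine ⟨hc, ?_, not_isLocMax_f7 hc (by linarith)⟩
    exact not_isLocMin_of_sq (γ := fun t => (x, t)) (a := y)
      (g := fun t => (t + y) ^ 2 * (t ^ 2 - y ^ 2 - 2 * x))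
      (by fun_prop) rfl (by fun_prop) (mul_neg_of_pos_of_neg hy (by linarith)) (f7_snd_eq h hx)

lemma f7_eq_add {x y : ℝ} (h : y ^ 2 - 1 = x) (hx : x ^ 2 = 1 / 6) (a b : ℝ) :
    f7 a b = f7 x y + (2 * x * (a + (b ^ 2 - 1) - 2 * x) ^ 2 +
      ((a - x) ^ 2 + (b ^ 2 - 1 - x) ^ 2) * (a + (b ^ 2 - 1))) := by
  obtain hy : y ^ 2 = 1 + x := by linarith
  have e' : y ^ 4 = (1 + x) ^ 2 := by rw [← hy]; ring
  simp only [f7, e', hy]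
  linear_combination (6 * (a + (b ^ 2 - 1)) - 12 * x) * hx

lemma isLocMin_f7 {x y : ℝ} (h : y ^ 2 - 1 = x) (hx : x ^ 2 = 1 / 6) (hpos : 0 < x) :
    IsLocMin f7 (x, y) := by
  have hc : ContinuousAt (fun q : ℝ × ℝ => q.1 + (q.2 ^ 2 - 1)) (x, y) := by fun_prop
  filter_upwards [hc.eventually_const_lt (show 0 < x + (y ^ 2 - 1) by linarith)] with q hq
  rw [f7_eq_add h hx q.1 q.2]
  exact le_add_of_nonneg_right (by positivity)

lemma isLocMax_f7 {x y : ℝ} (h : y ^ 2 - 1 = x) (hx : x ^ 2 = 1 / 6) (hneg : x < 0) :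
    IsLocMax f7 (x, y) := by
  have hc : ContinuousAt (fun q : ℝ × ℝ => q.1 + (q.2 ^ 2 - 1)) (x, y) := by fun_prop
  filter_upwards [hc.eventually_lt_const (show x + (y ^ 2 - 1) < 0 by linarith)] with q hq
  rw [f7_eq_add h hx q.1 q.2]
  exact add_le_of_nonpos_right (add_nonpos
    (mul_nonpos_of_nonpos_of_nonneg (by linarith) (sq_nonneg _))
    (mul_nonpos_of_nonneg_of_nonpos (by positivity) hq.le))

lemma isLocMin_f7_axis : IsLocMin f7 (2 / 3, 0) := by
  have h₁ : ContinuousAt (fun q : ℝ × ℝ => q.1) (2 / 3, 0) := by fun_prop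
  have h₂ : ContinuousAt (fun q : ℝ × ℝ => q.2 ^ 2) (2 / 3, 0) := by fun_prop
  filter_upwards [h₁.eventually_const_lt (show (0 : ℝ) < 2 / 3 by norm_num),
    h₂.eventually_lt_const (show (0 : ℝ) ^ 2 < 1 / 3 by norm_num)] with ⟨x, y⟩ hx hy
  simp only at hx hy
  have e : f7 x y = f7 (2 / 3) 0 + ((x - 2 / 3) ^ 2 * (x + 1 / 3) +
      y ^ 2 * ((x - 1) ^ 2 + (1 - 3 * y ^ 2) + y ^ 2 * x + y ^ 4)) := by
    simp only [f7]; ring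
  have : 0 < 1 - 3 * y ^ 2 := by linarith
  simp only [e]
  exact le_add_of_nonneg_right (by positivity)

lemma setOf_isLocMin_f7 :
    {p : ℝ × ℝ | IsCriticalPt f7 p ∧ IsLocMin f7 p} =
      {(2 / 3, 0), (√(1 / 6), √(1 + √(1 / 6))), (√(1 / 6), -√(1 + √(1 / 6)))} := by
  have hs : 0 < √(1 / 6 : ℝ) := by positivity
  have hs2 : √(1 / 6 : ℝ) ^ 2 = 1 / 6 := Real.sq_sqrt (by norm_num)
  have hr : √(1 + √(1 / 6 : ℝ)) ^ 2 = 1 + √(1 / 6) := Real.sq_sqrt (by positivity)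
  ext ⟨x, y⟩
  simp only [Set.mem_ofPred_eq, Set.mem_insert_iff, Set.mem_singleton_iff, Prod.mk.injEq]
  constructor
  · rintro ⟨hc, hm⟩
    rcases (isCriticalPt_f7_iff_cases x y).1 hc with
      ⟨rfl, rfl⟩ | ⟨rfl, rfl⟩ | ⟨h, hx⟩ | ⟨h, hx⟩
    · exact absurd hm isSaddle_f7_origin.2.1
    · exact .inl ⟨rfl, rfl⟩
    · rcases sq_eq_sq_iff_eq_or_eq_neg.1 (hx.trans hs2.symm) with rfl | rfl
      · rcases sq_eq_sq_iff_eq_or_eq_neg.1 ((show y ^ 2 = _ by linarith).trans hr.symm) with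
          rfl | rfl
        · exact .inr (.inl ⟨rfl, rfl⟩)
        · exact .inr (.inr ⟨rfl, rfl⟩)
      · exact absurd hm (not_isLocMin_f7 hc (by linarith))
    · exact absurd hm (isSaddle_f7 h hx).2.1
  · have key : ∀ y : ℝ, y ^ 2 = 1 + √(1 / 6) →
        IsCriticalPt f7 (√(1 / 6), y) ∧ IsLocMin f7 (√(1 / 6), y) := fun y hy =>
      ⟨(isCriticalPt_f7_iff_cases _ _).2 (.inr (.inr (.inl ⟨by linarith, hs2⟩))),
        isLocMin_f7 (by linarith) hs2 hs⟩
    rintro (⟨rfl, rfl⟩ | ⟨rfl, rfl⟩ | ⟨rfl, rfl⟩)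
    · exact ⟨(isCriticalPt_f7_iff_cases _ _).2 (.inr (.inl ⟨rfl, rfl⟩)), isLocMin_f7_axis⟩
    · exact key _ hr
    · exact key _ ((neg_sq _).trans hr)

lemma setOf_isLocMax_f7 :
    {p : ℝ × ℝ | IsCriticalPt f7 p ∧ IsLocMax f7 p} =
      {(-√(1 / 6), √(1 - √(1 / 6))), (-√(1 / 6), -√(1 - √(1 / 6)))} := by
  have hs : 0 < √(1 / 6 : ℝ) := by positivity
  have hs2 : √(1 / 6 : ℝ) ^ 2 = 1 / 6 := Real.sq_sqrt (by norm_num)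
  have hr : √(1 - √(1 / 6 : ℝ)) ^ 2 = 1 - √(1 / 6) := Real.sq_sqrt (by nlinarith)
  ext ⟨x, y⟩
  simp only [Set.mem_ofPred_eq, Set.mem_insert_iff, Set.mem_singleton_iff, Prod.mk.injEq]
  constructor
  · rintro ⟨hc, hm⟩
    rcases (isCriticalPt_f7_iff_cases x y).1 hc with
      ⟨rfl, rfl⟩ | ⟨rfl, rfl⟩ | ⟨h, hx⟩ | ⟨h, hx⟩
    · exact absurd hm isSaddle_f7_origin.2.2
    · exact absurd hm (not_isLocMax_f7 hc (by norm_num))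
    · rcases sq_eq_sq_iff_eq_or_eq_neg.1 (hx.trans hs2.symm) with rfl | rfl
      · exact absurd hm (not_isLocMax_f7 hc (by linarith))
      · rcases sq_eq_sq_iff_eq_or_eq_neg.1 ((show y ^ 2 = _ by linarith).trans hr.symm) with
          rfl | rfl
        · exact .inl ⟨rfl, rfl⟩
        · exact .inr ⟨rfl, rfl⟩
    · exact absurd hm (isSaddle_f7 h hx).2.2
  · have hn : (-√(1 / 6 : ℝ)) ^ 2 = 1 / 6 := (neg_sq _).trans hs2
    have key : ∀ y : ℝ, y ^ 2 = 1 - √(1 / 6) →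
        IsCriticalPt f7 (-√(1 / 6), y) ∧ IsLocMax f7 (-√(1 / 6), y) := fun y hy =>
      ⟨(isCriticalPt_f7_iff_cases _ _).2 (.inr (.inr (.inl ⟨by linarith, hn⟩))),
        isLocMax_f7 (by linarith) hn (by linarith)⟩
    rintro (⟨rfl, rfl⟩ | ⟨rfl, rfl⟩)
    · exact key _ hr
    · exact key _ ((neg_sq _).trans hr)

lemma setOf_isSaddle_f7 :
    {p : ℝ × ℝ | IsSaddle f7 p} =
      {(0, 0), (√(1 / 2), √(1 - √(1 / 2))), (√(1 / 2), -√(1 - √(1 / 2))),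
        (-√(1 / 2), √(1 + √(1 / 2))), (-√(1 / 2), -√(1 + √(1 / 2)))} := by
  have hs2 : √(1 / 2 : ℝ) ^ 2 = 1 / 2 := Real.sq_sqrt (by norm_num)
  have hn : (-√(1 / 2 : ℝ)) ^ 2 = 1 / 2 := (neg_sq _).trans hs2
  have hr : √(1 - √(1 / 2 : ℝ)) ^ 2 = 1 - √(1 / 2) := Real.sq_sqrt (by nlinarith)
  have hr' : √(1 + √(1 / 2 : ℝ)) ^ 2 = 1 + √(1 / 2) := Real.sq_sqrt (by positivity)
  ext ⟨x, y⟩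
  simp only [Set.mem_ofPred_eq, Set.mem_insert_iff, Set.mem_singleton_iff, Prod.mk.injEq]
  constructor
  · rintro ⟨hc, hmin, hmax⟩
    rcases (isCriticalPt_f7_iff_cases x y).1 hc with
      ⟨rfl, rfl⟩ | ⟨rfl, rfl⟩ | ⟨h, hx⟩ | ⟨h, hx⟩
    · exact .inl ⟨rfl, rfl⟩
    · exact absurd isLocMin_f7_axis hmin
    · have hx0 : x ≠ 0 := by rintro rfl; norm_num at hx
      rcases hx0.lt_or_gt with hneg | hpos
      · exact absurd (isLocMax_f7 h hx hneg) hmax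
      · exact absurd (isLocMin_f7 h hx hpos) hmin
    · rcases sq_eq_sq_iff_eq_or_eq_neg.1 (hx.trans hs2.symm) with rfl | rfl
      · rcases sq_eq_sq_iff_eq_or_eq_neg.1 ((show y ^ 2 = _ by linarith).trans hr.symm) with
          rfl | rfl <;> simp
      · rcases sq_eq_sq_iff_eq_or_eq_neg.1 ((show y ^ 2 = _ by linarith).trans hr'.symm) with
          rfl | rfl <;> simp
  · rintro (⟨rfl, rfl⟩ | ⟨rfl, rfl⟩ | ⟨rfl, rfl⟩ | ⟨rfl, rfl⟩ | ⟨rfl, rfl⟩)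
    · exact isSaddle_f7_origin
    · exact isSaddle_f7 (by linarith) hs2
    · exact isSaddle_f7 (by rw [neg_sq]; linarith) hs2
    · exact isSaddle_f7 (by linarith) hn
    · exact isSaddle_f7 (by rw [neg_sq]; linarith) hn

lemma ncard_pm_pair {a b : ℝ} (hb : 0 < b) : ({(a, b), (a, -b)} : Set (ℝ × ℝ)).ncard = 2 :=
  Set.ncard_pair fun h => by linarith [(Prod.mk.inj h).2]

lemma ncard_axis_pm_pair {a b c : ℝ} (hb : 0 < b) :
    ({(c, 0), (a, b), (a, -b)} : Set (ℝ × ℝ)).ncard = 3 := by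
  rw [Set.ncard_insert_of_notMem _ (by simp), ncard_pm_pair hb]
  simp [hb.ne, hb.ne']

lemma ncard_origin_two_pm_pairs {c a b : ℝ} (hc : 0 < c) (ha : 0 < a) (hb : 0 < b) :
    ({(0, 0), (c, a), (c, -a), (-c, b), (-c, -b)} : Set (ℝ × ℝ)).ncard = 5 := by
  have hcc : c ≠ -c := by linarith
  have haa : a ≠ -a := by linarith
  rw [Set.ncard_insert_of_notMem _ (by simp), Set.ncard_insert_of_notMem _ (by simp),
    Set.ncard_insert_of_notMem _ (by simp), ncard_pm_pair hb]
  all_goals simp [hc.ne, hc.ne', ha.ne, hcc, haa]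

lemma setOf_isCriticalPt_eq_union (f : ℝ → ℝ → ℝ) :
    {p : ℝ × ℝ | IsCriticalPt f p} =
      {p | IsCriticalPt f p ∧ IsLocMin f p} ∪ {p | IsCriticalPt f p ∧ IsLocMax f p} ∪
        {p | IsSaddle f p} := by
  ext p
  simp only [IsSaddle, Set.mem_union, Set.mem_ofPred_eq]
  tauto

lemma not_isLocMin_and_isLocMax_f7 {p : ℝ × ℝ} (hc : IsCriticalPt f7 p) :
    ¬ (IsLocMin f7 p ∧ IsLocMax f7 p) := by
  obtain ⟨x, y⟩ := p
  rintro ⟨hmin, hmax⟩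
  rcases lt_trichotomy (3 * x + (y ^ 2 - 1)) 0 with h | h | h
  · exact not_isLocMin_f7 hc h hmin
  · rcases (isCriticalPt_f7_iff_cases x y).1 hc with
      ⟨rfl, rfl⟩ | ⟨rfl, rfl⟩ | ⟨h', hx⟩ | ⟨h', hx⟩
    · norm_num at h
    · norm_num at h
    · obtain rfl : x = 0 := by linarith
      norm_num at hx
    · obtain rfl : x = 0 := by linarith
      norm_num at hx
  · exact not_isLocMax_f7 hc h hmax

/-- The polynomial `f7` has only nondegenerate critical points; it has exactly
10 critical points, of which exactly 3 are local minima, exactly 5 are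
saddles, and exactly 2 are local maxima. -/
theorem morse_data_f7 :
    (∀ p : ℝ × ℝ, IsCriticalPt f7 p → hessDet f7 p ≠ 0) ∧
    {p : ℝ × ℝ | IsCriticalPt f7 p}.Finite ∧
    {p : ℝ × ℝ | IsCriticalPt f7 p}.ncard = 10 ∧
    {p : ℝ × ℝ | IsCriticalPt f7 p ∧ IsLocMin f7 p}.ncard = 3 ∧
    {p : ℝ × ℝ | IsSaddle f7 p}.ncard = 5 ∧
    {p : ℝ × ℝ | IsCriticalPt f7 p ∧ IsLocMax f7 p}.ncard = 2 := by
  have hmin : {p : ℝ × ℝ | IsCriticalPt f7 p ∧ IsLocMin f7 p}.ncard = 3 := by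
    rw [setOf_isLocMin_f7]
    exact ncard_axis_pm_pair (by positivity)
  have hmax : {p : ℝ × ℝ | IsCriticalPt f7 p ∧ IsLocMax f7 p}.ncard = 2 := by
    rw [setOf_isLocMax_f7]
    refine ncard_pm_pair (Real.sqrt_pos.2 (sub_pos.2 ?_))
    rw [Real.sqrt_lt' one_pos]
    norm_num
  have hsad : {p : ℝ × ℝ | IsSaddle f7 p}.ncard = 5 := by
    rw [setOf_isSaddle_f7]
    refine ncard_origin_two_pm_pairs (by positivity) (Real.sqrt_pos.2 (sub_pos.2 ?_))
      (by positivity)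
    rw [Real.sqrt_lt' one_pos]
    norm_num
  have fmin := Set.finite_of_ncard_ne_zero (hmin ▸ three_ne_zero)
  have fmax := Set.finite_of_ncard_ne_zero (hmax ▸ two_ne_zero)
  have fsad := Set.finite_of_ncard_ne_zero (hsad ▸ (by norm_num : 5 ≠ 0))
  refine ⟨fun p hp => hessDet_f7_ne_zero hp, ?_, ?_, hmin, hsad, hmax⟩
  · rw [setOf_isCriticalPt_eq_union]
    exact (fmin.union fmax).union fsad
  · rw [setOf_isCriticalPt_eq_union, Set.ncard_union_eq ?_ (fmin.union fmax) fsad,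
      Set.ncard_union_eq ?_ fmin fmax, hmin, hmax, hsad]
    · exact Set.disjoint_left.2 fun p h₁ h₂ => not_isLocMin_and_isLocMax_f7 h₁.1 ⟨h₁.2, h₂.2⟩
    · refine Set.disjoint_left.2 ?_
      rintro p (h | h) hs
      · exact hs.2.1 h.2
      · exact hs.2.2 h.2
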